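/- Let (G,S) be a Coxeter system with S finite, let V be a representation of G over a field of characteristic ≠ 2, and let s ∈ S. Let G_s = ⟨S∖{s}⟩ and G^s = ⟨S∖B_s(1)⟩, where B_s(1) is the set consisting of s and all vertices adjacent to s in the Coxeter graph (so every element of G^s commutes with s, and the invariant space V^s is a G^s-representation). Then there is a long exact sequence ⋯ → H_C^{i-1}(G^s, V^s) → H_C^i(G, V) → H_C^i(G_s, V) → H_C^i(G^s, V^s) → ⋯. -/

import Mathlib

set_option linter.unusedSectionVars false

open Finset

section CoxeterCochain

variable {B : Type*} [DecidableEq B] [Fintype B]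
variable {W : Type*} [Group W] {M : CoxeterMatrix B} (cs : CoxeterSystem M W)

/-- A subset `T` of the generating set is *independent* if the corresponding simple
reflections pairwise commute. -/
def Indep (T : Finset B) : Prop :=
  ∀ i ∈ T, ∀ j ∈ T, i ≠ j → Commute (cs.simple i) (cs.simple j)

lemma Indep.mono {T T' : Finset B} (hT : Indep cs T) (h : T' ⊆ T) : Indep cs T' :=
  fun i hi j hj hij => hT i (h hi) j (h hj) hij

variable (R : Type*) [CommRing R] (A : Type*) [AddCommGroup A] [Module R A]
  [DistribMulAction W A] [SMulCommClass W R A]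

/-- The submodule of invariants `A^{⟨T⟩}` of the subgroup generated by the
simple reflections indexed by `T`. -/
def invSub (T : Finset B) : Submodule R A where
  carrier := {a | ∀ i ∈ T, cs.simple i • a = a}
  add_mem' ha hb := fun i hi => by rw [smul_add, ha i hi, hb i hi]
  zero_mem' := fun i hi => smul_zero _
  smul_mem' r a ha := fun i hi => by rw [smul_comm, ha i hi]

lemma mem_invSub {T : Finset B} {a : A} :
    a ∈ invSub cs R A T ↔ ∀ i ∈ T, cs.simple i • a = a := Iff.rfl

/-- The degree `k` part of the Coxeter cochain complex: the direct sum (= product, as the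
index set is finite) over all independent `k`-element subsets `T` of the invariants `A^{⟨T⟩}`. -/
abbrev Xc (k : ℕ) : Type _ :=
  ∀ T : {T : Finset B // Indep cs T ∧ T.card = k}, invSub cs R A T.1

/-- The sign `(-1)^{#{t ∈ T | t < s}}` (with respect to a chosen linear order on `B`). -/
def csgn (o : LinearOrder B) (T : Finset B) (s : B) : ℤ :=
  letI := o
  (-1) ^ (T.filter (fun t => t < s)).card

lemma step_mem {T : Finset B} (hT : Indep cs T) {s : B} (hs : s ∈ T) {a : A}
    (ha : a ∈ invSub cs R A (T.erase s)) :
    a + cs.simple s • a ∈ invSub cs R A T := by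
  intro i hi
  rcases eq_or_ne i s with rfl | h
  · rw [smul_add, smul_smul, cs.simple_mul_simple_self, one_smul, add_comm]
  · have hcomm : Commute (cs.simple i) (cs.simple s) := hT i hi s hs h
    have hai : cs.simple i • a = a := ha i (Finset.mem_erase.mpr ⟨h, hi⟩)
    rw [smul_add, hai, smul_smul, hcomm.eq, ← smul_smul, hai]

/-- The independent set obtained by deleting `s` from `U`. -/
def Usub {k : ℕ} (U : {T : Finset B // Indep cs T ∧ T.card = k + 1}) (s : {x // x ∈ U.1}) :
    {T : Finset B // Indep cs T ∧ T.card = k} :=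
  ⟨U.1.erase s.1, Indep.mono cs U.2.1 (Finset.erase_subset _ _),
    by simp [Finset.card_erase_of_mem s.2, U.2.2]⟩

/-- The differential of the Coxeter cochain complex: the sum of the maps
`d_{T,s} : v ↦ (-1)^{#{t ∈ T | t < s}} (v + s • v)`. -/
def Xd (o : LinearOrder B) (k : ℕ) : Xc cs R A k →ₗ[R] Xc cs R A (k + 1) where
  toFun x U :=
    ⟨∑ s ∈ U.1.attach,
        csgn o (U.1.erase s.1) s.1 •
          ((x (Usub cs U s) : A) + cs.simple s.1 • (x (Usub cs U s) : A)),
      Submodule.sum_mem _ fun s _ => zsmul_mem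
        (step_mem cs R A U.2.1 s.2 (x (Usub cs U s)).2) _⟩
  map_add' x y := by
    funext U
    apply Subtype.ext
    simp only [Pi.add_apply, Submodule.coe_add]
    rw [← Finset.sum_add_distrib]
    refine Finset.sum_congr rfl fun s _ => ?_
    rw [← smul_add]
    congr 1
    rw [smul_add]
    abel
  map_smul' r x := by
    funext U
    apply Subtype.ext
    simp only [Pi.smul_apply, SetLike.val_smul, RingHom.id_apply]
    rw [Finset.smul_sum]
    refine Finset.sum_congr rfl fun s _ => ?_
    rw [smul_comm (cs.simple s.1) r, ← smul_add, smul_comm]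

/-- Cocycles of the Coxeter cochain complex. -/
def Zc (o : LinearOrder B) (i : ℕ) : Submodule R (Xc cs R A i) := LinearMap.ker (Xd cs R A o i)

/-- Coboundaries of the Coxeter cochain complex. -/
def Bc (o : LinearOrder B) : (i : ℕ) → Submodule R (Xc cs R A i)
  | 0 => ⊥
  | (i + 1) => LinearMap.range (Xd cs R A o i)

/-- The Coxeter cohomology `H^i_C(G, A)` of the Coxeter system `cs` with coefficients in `A`,
with respect to the linear order `o` on the generators. -/
abbrev CoxH (o : LinearOrder B) (i : ℕ) : Type _ :=
  Zc cs R A o i ⧸ (Bc cs R A o i).comap (Zc cs R A o i).subtype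

end CoxeterCochain

section ParabolicAction

/-- If `M i j = 2` then the simple reflections `i` and `j` commute. -/
lemma commute_simple_of_two {B : Type*} {W : Type*} [Group W] {M : CoxeterMatrix B}
    (cs : CoxeterSystem M W) {i j : B} (h : M i j = 2) :
    Commute (cs.simple i) (cs.simple j) := by
  have h1 := cs.simple_mul_simple_pow i j
  rw [h, pow_two] at h1
  have h2 : cs.simple i * cs.simple j = (cs.simple i * cs.simple j)⁻¹ :=
    eq_inv_of_mul_eq_one_left h1
  show cs.simple i * cs.simple j = cs.simple j * cs.simple i
  rw [h2, mul_inv_rev, cs.inv_simple, cs.inv_simple]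

/-- Every element of the parabolic subgroup `G^s`, generated by the simple reflections that
are distinct from `s` and not adjacent to `s` in the Coxeter graph, commutes with `s`. -/
lemma commute_simple_of_nonadjacent {B : Type*} {W : Type*} [Group W] {M : CoxeterMatrix B}
    (cs : CoxeterSystem M W) (s : B)
    {W₂ : Type*} [Group W₂] {M₂ : CoxeterMatrix {b : B // b ≠ s ∧ M b s = 2}}
    (cs₂ : CoxeterSystem M₂ W₂) (φ₂ : W₂ →* W)
    (h₂ : ∀ b : {b : B // b ≠ s ∧ M b s = 2}, φ₂ (cs₂.simple b) = cs.simple b.1)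
    (w : W₂) : Commute (cs.simple s) (φ₂ w) := by
  refine cs₂.simple_induction (p := fun w => Commute (cs.simple s) (φ₂ w)) w
    (fun b => ?_) ?_ (fun x y hx hy => ?_)
  · show Commute (cs.simple s) (φ₂ (cs₂.simple b))
    rw [h₂ b]
    exact commute_simple_of_two cs (M.symmetric b.1 s ▸ b.2.2)
  · show Commute (cs.simple s) (φ₂ 1)
    rw [map_one]
    exact Commute.one_right _
  · show Commute (cs.simple s) (φ₂ (x * y))
    rw [map_mul]
    exact Commute.mul_right hx hy

/-- The action of the parabolic subgroup `G^s` on the invariant subspace `V^s`. -/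
def parabolicInvAction {B : Type*} [DecidableEq B] {W : Type*} [Group W]
    {M : CoxeterMatrix B} (cs : CoxeterSystem M W) (s : B)
    {W₂ : Type*} [Group W₂] {M₂ : CoxeterMatrix {b : B // b ≠ s ∧ M b s = 2}}
    (cs₂ : CoxeterSystem M₂ W₂) (φ₂ : W₂ →* W)
    (h₂ : ∀ b : {b : B // b ≠ s ∧ M b s = 2}, φ₂ (cs₂.simple b) = cs.simple b.1)
    (K : Type*) [Field K] (V : Type*) [AddCommGroup V] [Module K V]
    [DistribMulAction W V] [SMulCommClass W K V] :
    DistribMulAction W₂ (invSub cs K V {s}) where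
  smul w v := ⟨φ₂ w • v.1, by
    intro i hi
    rw [Finset.mem_singleton] at hi
    subst hi
    have hv : cs.simple i • (v : V) = (v : V) := v.2 i (Finset.mem_singleton_self i)
    rw [smul_smul, (commute_simple_of_nonadjacent cs i cs₂ φ₂ h₂ w).eq, ← smul_smul, hv]⟩
  one_smul v := Subtype.ext (by show φ₂ 1 • v.1 = v.1; rw [map_one, one_smul])
  mul_smul g h v := Subtype.ext (by
    show φ₂ (g * h) • v.1 = φ₂ g • (φ₂ h • v.1)
    rw [map_mul, mul_smul])
  smul_zero w := Subtype.ext (by show φ₂ w • (0 : V) = 0; rw [smul_zero])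
  smul_add w v₁ v₂ := Subtype.ext (by
    show φ₂ w • (v₁.1 + v₂.1) = φ₂ w • v₁.1 + φ₂ w • v₂.1
    rw [smul_add])

end ParabolicAction


noncomputable def gcoef {B : Type*} (M : CoxeterMatrix B) (i j : B) : ℝ :=
  -2 * Real.cos (Real.pi / (M i j : ℝ))

noncomputable def gform {B : Type*} [Fintype B] (M : CoxeterMatrix B) (i : B) :
    Module.Dual ℝ (B → ℝ) :=
  ∑ j, gcoef M i j • LinearMap.proj j

lemma gform_single {B : Type*} [Fintype B] [DecidableEq B] (M : CoxeterMatrix B) (i j : B) :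
    gform M i (Pi.single j 1) = gcoef M i j := by
  simp [gform, Pi.single_apply]

lemma gform_self {B : Type*} [Fintype B] [DecidableEq B] (M : CoxeterMatrix B) (i : B) :
    gform M i (Pi.single i 1) = 2 := by
  rw [gform_single, gcoef, M.diagonal]; simp

open Polynomial.Chebyshev in
lemma refl_pow {E : Type*} [AddCommGroup E] [Module ℝ E] {x y : E} {f g : Module.Dual ℝ E}
    (hf : f x = 2) (hg : g y = 2) (m : ℕ) (hm : 3 ≤ m)
    (h1 : f y = -2 * Real.cos (Real.pi / m)) (h2 : g x = -2 * Real.cos (Real.pi / m)) :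
    (Module.reflection hf * Module.reflection hg) ^ m = 1 := by
  have hm0 : (m : ℝ) ≠ 0 := by positivity
  set θ : ℝ := 2 * (Real.pi / m) with hθ
  have ht : 2 * Real.cos θ = f y * g x - 2 := by
    rw [h1, h2, hθ, Real.cos_two_mul]; ring
  have hmθ : m * θ = 2 * Real.pi := by rw [hθ]; field_simp
  have hs : Real.sin θ ≠ 0 := by
    apply ne_of_gt
    apply Real.sin_pos_of_pos_of_lt_pi
    · have := Real.pi_pos; positivity
    · have h3 : (3 : ℝ) ≤ m := by exact_mod_cast hm
      have h4 : Real.pi / m ≤ Real.pi / 3 := by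
        apply div_le_div_of_nonneg_left Real.pi_pos.le (by norm_num) h3
      have := Real.pi_pos
      rw [hθ]; linarith
  have hS : ∀ n : ℤ, (S ℝ n).eval (2 * Real.cos θ) = Real.sin ((n + 1) * θ) / Real.sin θ := by
    intro n; rw [eq_div_iff hs]; exact S_two_mul_real_cos θ n
  apply LinearEquiv.toLinearMap_injective
  ext z
  have key := Module.reflection_mul_reflection_pow hf hg m (2 * Real.cos θ) ht
  rw [key]
  obtain ⟨k, hk | hk⟩ := Nat.even_or_odd' m
  · have e1 : ((m : ℤ) - 2) / 2 = k - 1 := by omega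
    have e2 : ((m : ℤ) - 1) / 2 = k - 1 := by omega
    have hz : (S ℝ ((k : ℤ) - 1)).eval (2 * Real.cos θ) = 0 := by
      rw [hS]
      have : ((((k : ℤ) - 1 : ℤ) : ℝ) + 1) * θ = Real.pi := by
        have : (m : ℝ) = 2 * k := by exact_mod_cast hk
        rw [this] at hmθ
        push_cast
        linarith
      rw [this]; simp
    rw [e1, e2, hz]
    simp
  · have e1 : ((m : ℤ) - 2) / 2 = k - 1 := by omega
    have e2 : ((m : ℤ) - 1) / 2 = k := by omega
    have e3 : ((m : ℤ) - 3) / 2 = k - 1 := by omega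
    have e4 : (m : ℤ) / 2 = k := by omega
    have hz : (S ℝ (k : ℤ)).eval (2 * Real.cos θ) + (S ℝ ((k : ℤ) - 1)).eval (2 * Real.cos θ)
        = 0 := by
      rw [hS, hS]
      have : ((k : ℤ) + 1 : ℝ) * θ = 2 * Real.pi - (((k : ℤ) - 1 : ℤ) + 1 : ℝ) * θ := by
        have : (m : ℝ) = 2 * k + 1 := by exact_mod_cast hk
        rw [this] at hmθ
        push_cast
        linarith
      rw [this, Real.sin_two_pi_sub]; ring
    rw [e1, e2, e3, e4, hz]
    simp

lemma liftable {B : Type*} [Fintype B] [DecidableEq B] (M : CoxeterMatrix B) :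
    M.IsLiftable (fun i => Module.reflection (gform_self M i)) := by
  intro i j
  rcases eq_or_ne i j with rfl | hij
  · rw [M.diagonal, pow_one]
    ext1 z
    exact Module.involutive_reflection _ z
  have hne : M i j ≠ 1 := M.off_diagonal i j hij
  have h1 : gform M i (Pi.single j 1) = gcoef M i j := gform_single M i j
  have h2 : gform M j (Pi.single i 1) = gcoef M i j := by
    rw [gform_single, gcoef, gcoef, M.symmetric]
  by_cases h0 : M i j = 0
  · rw [h0, pow_zero]
  by_cases htwo : M i j = 2
  · have hc : gcoef M i j = 0 := by simp [gcoef, htwo]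
    rw [hc] at h1 h2
    rw [htwo]
    ext1 z
    simp only [pow_two, LinearEquiv.mul_apply, Module.reflection_apply, map_sub, map_smul, h1, h2,
      gform_self, LinearEquiv.coe_one, id]
    module
  · exact refl_pow _ _ _ (by omega) h1 h2

lemma two_of_commute {B : Type*} [Fintype B] [DecidableEq B] {M : CoxeterMatrix B} {W : Type*}
    [Group W] (cs : CoxeterSystem M W) {i j : B} (hij : i ≠ j)
    (h : Commute (cs.simple i) (cs.simple j)) : M i j = 2 := by
  have h' := h.map (cs.lift ⟨_, liftable M⟩)
  rw [cs.lift_apply_simple (liftable M), cs.lift_apply_simple (liftable M)] at h'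
  have h3 := congrArg (fun e => e (Pi.single j 1) i) h'.eq
  have hs : gcoef M j i = gcoef M i j := by rw [gcoef, gcoef, M.symmetric]
  simp [LinearEquiv.mul_apply, Module.reflection_apply, gform_single, hs, hij] at h3
  have hc : gcoef M i j = 0 := by
    linarith
  have hc' : Real.cos (Real.pi / (M i j : ℝ)) = 0 := by
    simpa [gcoef] using hc
  by_contra hne
  have hne1 : M i j ≠ 1 := M.off_diagonal i j hij
  rcases Nat.eq_zero_or_pos (M i j) with h0 | hpos
  · rw [h0] at hc'; simp at hc'
  · have h3 : (3 : ℝ) ≤ M i j := by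
      have : 3 ≤ M i j := by omega
      exact_mod_cast this
    have h4 : Real.pi / (M i j : ℝ) ≤ Real.pi / 3 :=
      div_le_div_of_nonneg_left Real.pi_pos.le (by norm_num) h3
    have := Real.pi_pos
    have h5 : 0 < Real.cos (Real.pi / (M i j : ℝ)) := by
      apply Real.cos_pos_of_mem_Ioo
      constructor
      · have : 0 < Real.pi / (M i j : ℝ) := by positivity
        linarith
      · linarith
    linarith

section AbstractLES
universe u₁ u₂ u₃ u₄

lemma abstract_les {K : Type u₁} [CommRing K]
    {X : ℕ → Type u₂} [∀ i, AddCommGroup (X i)] [∀ i, Module K (X i)]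
    {C : ℕ → Type u₃} [∀ i, AddCommGroup (C i)] [∀ i, Module K (C i)]
    {A : ℕ → Type u₄} [∀ i, AddCommGroup (A i)] [∀ i, Module K (A i)]
    (dX : ∀ i, X i →ₗ[K] X (i + 1)) (dC : ∀ i, C i →ₗ[K] C (i + 1)) (dA : ∀ i, A i →ₗ[K] A (i + 1))
    (ZX : ∀ i, Submodule K (X i)) (ZC : ∀ i, Submodule K (C i)) (ZA : ∀ i, Submodule K (A i))
    (BX : ∀ i, Submodule K (X i)) (BC : ∀ i, Submodule K (C i)) (BA : ∀ i, Submodule K (A i))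
    (hZX : ∀ i x, x ∈ ZX i ↔ dX i x = 0) (hZC : ∀ i x, x ∈ ZC i ↔ dC i x = 0)
    (hZA : ∀ i x, x ∈ ZA i ↔ dA i x = 0)
    (hBX0 : ∀ x, x ∈ BX 0 ↔ x = 0) (hBX : ∀ i x, x ∈ BX (i + 1) ↔ ∃ y, dX i y = x)
    (hBC0 : ∀ x, x ∈ BC 0 ↔ x = 0) (hBC : ∀ i x, x ∈ BC (i + 1) ↔ ∃ y, dC i y = x)
    (hBA0 : ∀ x, x ∈ BA 0 ↔ x = 0) (hBA : ∀ i x, x ∈ BA (i + 1) ↔ ∃ y, dA i y = x)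
    (r : ∀ i, X i →ₗ[K] C i) (σ : ∀ i, C i →ₗ[K] X i)
    (j : ∀ i, A i →ₗ[K] X (i + 1)) (p : ∀ i, X (i + 1) →ₗ[K] A i)
    (hdd : ∀ i x, dX (i + 1) (dX i x) = 0)
    (hr : ∀ i x, r (i + 1) (dX i x) = dC i (r i x))
    (hj : ∀ i x, dX (i + 1) (j i x) = j (i + 1) (dA i x))
    (hrσ : ∀ i x, r i (σ i x) = x) (hpj : ∀ i x, p i (j i x) = x)
    (hrj : ∀ i x, r (i + 1) (j i x) = 0)
    (h0 : ∀ x, σ 0 (r 0 x) = x)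
    (hsplit : ∀ i x, σ (i + 1) (r (i + 1) x) + j i (p i x) = x) :
    ∃ (α : ∀ i : ℕ, (ZX i ⧸ (BX i).comap (ZX i).subtype) →ₗ[K]
          (ZC i ⧸ (BC i).comap (ZC i).subtype))
      (β : ∀ i : ℕ, (ZC i ⧸ (BC i).comap (ZC i).subtype) →ₗ[K]
          (ZA i ⧸ (BA i).comap (ZA i).subtype))
      (γ : ∀ i : ℕ, (ZA i ⧸ (BA i).comap (ZA i).subtype) →ₗ[K]
          (ZX (i + 1) ⧸ (BX (i + 1)).comap (ZX (i + 1)).subtype)),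
      Function.Injective (α 0) ∧
      (∀ i : ℕ, Function.Exact (α i) (β i)) ∧
      (∀ i : ℕ, Function.Exact (β i) (γ i)) ∧
      (∀ i : ℕ, Function.Exact (γ i) (α (i + 1))) := by
  have hσr : ∀ i x, σ (i + 1) (r (i + 1) x) = x - j i (p i x) := fun i x =>
    eq_sub_of_add_eq (hsplit i x)
  have hjp : ∀ i x, j i (p i x) = x - σ (i + 1) (r (i + 1) x) := fun i x =>
    eq_sub_of_add_eq' (hsplit i x)
  have hjinj : ∀ i x, j i x = 0 → x = 0 := fun i x hx => by rw [← hpj i x, hx, map_zero]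
  let b : ∀ i, C i →ₗ[K] A i := fun i => p i ∘ₗ dX i ∘ₗ σ i
  have hb : ∀ i x, b i x = p i (dX i (σ i x)) := fun i x => rfl
  have hjb : ∀ i x, j i (b i x) = dX i (σ i x) - σ (i + 1) (dC i x) := by
    intro i x
    rw [hb, hjp, hr, hrσ]
  have hdb : ∀ i x, dA i (b i x) = - b (i + 1) (dC i x) := by
    intro i x
    rw [← hpj (i + 1) (dA i (b i x)), ← hj, hjb, map_sub, hdd, zero_sub, map_neg, hb (i + 1)]
  have mα : ∀ i (x : ZX i), r i x ∈ ZC i := by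
    intro i x
    rw [hZC, ← hr, (hZX i x).1 x.2, map_zero]
  have mβ : ∀ i (x : ZC i), b i x ∈ ZA i := by
    intro i x
    rw [hZA, hdb, (hZC i x).1 x.2, map_zero, neg_zero]
  have mγ : ∀ i (x : ZA i), j i x ∈ ZX (i + 1) := by
    intro i x
    rw [hZX, hj, (hZA i x).1 x.2, map_zero]
  let α' : ∀ i, ZX i →ₗ[K] ZC i := fun i => ((r i) ∘ₗ (ZX i).subtype).codRestrict (ZC i) (mα i)
  let β' : ∀ i, ZC i →ₗ[K] ZA i := fun i => ((b i) ∘ₗ (ZC i).subtype).codRestrict (ZA i) (mβ i)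
  let γ' : ∀ i, ZA i →ₗ[K] ZX (i + 1) :=
    fun i => ((j i) ∘ₗ (ZA i).subtype).codRestrict (ZX (i + 1)) (mγ i)
  have nα : ∀ i, (BX i).comap (ZX i).subtype ≤ ((BC i).comap (ZC i).subtype).comap (α' i) := by
    rintro i ⟨x, hx⟩ h
    change x ∈ BX i at h
    change r i x ∈ BC i
    cases i with
    | zero => rw [hBX0] at h; rw [hBC0, h, map_zero]
    | succ i =>
      rw [hBX] at h; rw [hBC]
      obtain ⟨y, rfl⟩ := h
      exact ⟨r i y, (hr i y).symm⟩
  have nβ : ∀ i, (BC i).comap (ZC i).subtype ≤ ((BA i).comap (ZA i).subtype).comap (β' i) := by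
    rintro i ⟨x, hx⟩ h
    change x ∈ BC i at h
    change b i x ∈ BA i
    cases i with
    | zero => rw [hBC0] at h; rw [hBA0, h, map_zero]
    | succ i =>
      rw [hBC] at h; rw [hBA]
      obtain ⟨y, rfl⟩ := h
      exact ⟨- b i y, by rw [map_neg, hdb, neg_neg]⟩
  have nγ : ∀ i, (BA i).comap (ZA i).subtype ≤
      ((BX (i + 1)).comap (ZX (i + 1)).subtype).comap (γ' i) := by
    rintro i ⟨x, hx⟩ h
    change x ∈ BA i at h
    change j i x ∈ BX (i + 1)
    cases i with
    | zero => rw [hBA0] at h; rw [h, map_zero]; exact zero_mem _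
    | succ i =>
      rw [hBA] at h; rw [hBX]
      obtain ⟨y, rfl⟩ := h
      exact ⟨j i y, hj i y⟩
  have qzC : ∀ i (x : ZC i),
      (Submodule.Quotient.mk x : ZC i ⧸ (BC i).comap (ZC i).subtype) = 0 ↔ (x : C i) ∈ BC i := by
    intro i x
    rw [Submodule.Quotient.mk_eq_zero]; rfl
  have qzA : ∀ i (x : ZA i),
      (Submodule.Quotient.mk x : ZA i ⧸ (BA i).comap (ZA i).subtype) = 0 ↔ (x : A i) ∈ BA i := by
    intro i x
    rw [Submodule.Quotient.mk_eq_zero]; rfl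
  have qzX : ∀ i (x : ZX i),
      (Submodule.Quotient.mk x : ZX i ⧸ (BX i).comap (ZX i).subtype) = 0 ↔ (x : X i) ∈ BX i := by
    intro i x
    rw [Submodule.Quotient.mk_eq_zero]; rfl
  refine ⟨fun i => Submodule.mapQ _ _ (α' i) (nα i), fun i => Submodule.mapQ _ _ (β' i) (nβ i),
    fun i => Submodule.mapQ _ _ (γ' i) (nγ i), ?_, ?_, ?_, ?_⟩
  · rw [injective_iff_map_eq_zero]
    intro x
    obtain ⟨⟨x, hx⟩, rfl⟩ := Submodule.Quotient.mk_surjective _ x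
    intro h
    rw [Submodule.mapQ_apply, qzC] at h
    rw [qzX]
    change r 0 x ∈ BC 0 at h
    change x ∈ BX 0
    rw [hBC0] at h
    rw [hBX0, ← h0 x, h, map_zero]
  · intro i z
    obtain ⟨⟨z, hz⟩, rfl⟩ := Submodule.Quotient.mk_surjective _ z
    rw [hZC] at hz
    rw [Submodule.mapQ_apply, qzA]
    change b i z ∈ BA i ↔ _
    constructor
    · intro h
      obtain ⟨x, hx, hxz⟩ : ∃ x, dX i x = 0 ∧ r i x = z := by
        cases i with
        | zero =>
          rw [hBA0] at h
          refine ⟨σ 0 z, ?_, hrσ _ _⟩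
          have := hjb 0 z
          rw [h, hz, map_zero, map_zero, sub_zero] at this
          exact this.symm
        | succ i =>
          rw [hBA] at h
          obtain ⟨y, hy⟩ := h
          refine ⟨σ (i + 1) z - j i y, ?_, ?_⟩
          · rw [map_sub, hj, hy, hjb, hz, map_zero, sub_zero, sub_self]
          · rw [map_sub, hrσ, hrj, sub_zero]
      refine ⟨Submodule.Quotient.mk ⟨x, (hZX i x).2 hx⟩, ?_⟩
      rw [Submodule.mapQ_apply]
      congr 1
      exact Subtype.ext hxz
    · rintro ⟨x, hx⟩
      obtain ⟨⟨x, hx'⟩, rfl⟩ := Submodule.Quotient.mk_surjective _ x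
      rw [hZX] at hx'
      rw [Submodule.mapQ_apply, ← sub_eq_zero, ← Submodule.Quotient.mk_sub, qzC] at hx
      change r i x - z ∈ BC i at hx
      have h1 : b i (r i x) ∈ BA i := by
        cases i with
        | zero => rw [hBA0, hb, h0, hx', map_zero]
        | succ i =>
          rw [hBA]
          refine ⟨- p i x, ?_⟩
          rw [hb, hσr, map_sub, hx', hj, zero_sub, map_neg, map_neg, hpj]
      have h2 : b i (r i x - z) ∈ BA i :=
        nβ i (x := ⟨r i x - z, (hZC _ _).2 (by rw [map_sub, ← hr, hx', hz, map_zero, sub_zero])⟩) hx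
      have := sub_mem h1 h2
      rwa [← map_sub, sub_sub_cancel] at this
  · intro i y
    obtain ⟨⟨y, hy⟩, rfl⟩ := Submodule.Quotient.mk_surjective _ y
    rw [hZA] at hy
    rw [Submodule.mapQ_apply, qzX]
    change j i y ∈ BX (i + 1) ↔ _
    constructor
    · intro h
      rw [hBX] at h
      obtain ⟨x, hx⟩ := h
      have hz : dC i (r i x) = 0 := by rw [← hr, hx, hrj]
      refine ⟨Submodule.Quotient.mk ⟨r i x, (hZC _ _).2 hz⟩, ?_⟩
      rw [Submodule.mapQ_apply, ← sub_eq_zero, ← Submodule.Quotient.mk_sub, qzA]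
      change b i (r i x) - y ∈ BA i
      cases i with
      | zero => rw [hBA0, hb, h0, hx, hpj, sub_self]
      | succ i =>
        rw [hBA]
        refine ⟨- p i x, ?_⟩
        rw [hb, hσr, map_sub, hx, hj, map_sub, hpj, hpj, map_neg]
        abel
    · rintro ⟨z, hz⟩
      obtain ⟨⟨z, hz'⟩, rfl⟩ := Submodule.Quotient.mk_surjective _ z
      rw [hZC] at hz'
      rw [Submodule.mapQ_apply, ← sub_eq_zero, ← Submodule.Quotient.mk_sub, qzA] at hz
      change b i z - y ∈ BA i at hz
      have h1 : j i (b i z) ∈ BX (i + 1) := by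
        rw [hBX]
        exact ⟨σ i z, by rw [hjb, hz', map_zero, sub_zero]⟩
      have h2 : j i (b i z - y) ∈ BX (i + 1) :=
        nγ i (x := ⟨b i z - y, (hZA _ _).2 (by
          rw [map_sub, hdb, hz', hy, map_zero, neg_zero, sub_zero])⟩) hz
      have := sub_mem h1 h2
      rwa [← map_sub, sub_sub_cancel] at this
  · intro i x
    obtain ⟨⟨x, hx⟩, rfl⟩ := Submodule.Quotient.mk_surjective _ x
    rw [hZX] at hx
    rw [Submodule.mapQ_apply, qzC]
    change r (i + 1) x ∈ BC (i + 1) ↔ _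
    constructor
    · intro h
      rw [hBC] at h
      obtain ⟨w, hw⟩ := h
      set x' := x - dX i (σ i w) with hx'
      have h1 : j i (p i x') = x' := by
        rw [hjp, hx', map_sub (r (i + 1)), hr, hrσ, hw, sub_self, map_zero, sub_zero]
      have h2 : dA i (p i x') = 0 := by
        apply hjinj
        rw [← hj, h1, hx', map_sub, hx, hdd, sub_zero]
      refine ⟨Submodule.Quotient.mk ⟨p i x', (hZA _ _).2 h2⟩, ?_⟩
      rw [Submodule.mapQ_apply, ← sub_eq_zero, ← Submodule.Quotient.mk_sub, qzX]
      change j i (p i x') - x ∈ BX (i + 1)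
      rw [h1, hBX]
      exact ⟨- σ i w, by rw [hx', map_neg]; abel⟩
    · rintro ⟨y, hy⟩
      obtain ⟨⟨y, hy'⟩, rfl⟩ := Submodule.Quotient.mk_surjective _ y
      rw [Submodule.mapQ_apply, ← sub_eq_zero, ← Submodule.Quotient.mk_sub, qzX] at hy
      change j i y - x ∈ BX (i + 1) at hy
      rw [hBX] at hy
      obtain ⟨w, hw⟩ := hy
      rw [hBC]
      refine ⟨- r i w, ?_⟩
      rw [map_neg, ← hr, hw, map_sub, hrj]
      abel

end AbstractLES
section Signs

/-- The elementary sign. -/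
def chi {B : Type*} (o : LinearOrder B) (a t : B) : ℤ :=
  letI := o
  if a < t then -1 else 1

lemma chi_sq {B : Type*} (o : LinearOrder B) (a t : B) : chi o a t * chi o a t = 1 := by
  unfold chi; split_ifs <;> rfl

lemma chi_anti {B : Type*} (o : LinearOrder B) {a t : B} (h : a ≠ t) :
    chi o a t = - chi o t a := by
  unfold chi
  rcases lt_or_gt_of_ne h with h1 | h1
  · simp [h1, h1.not_gt]
  · simp [h1, h1.not_gt]

lemma csgn_eq_prod {B : Type*} (o : LinearOrder B) (T : Finset B) (t : B) :
    csgn o T t = ∏ a ∈ T, chi o a t := by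
  unfold csgn chi
  rw [Finset.prod_ite]
  simp

lemma csgn_insert {B : Type*} [DecidableEq B] (o : LinearOrder B) {T : Finset B} {b : B}
    (hb : b ∉ T) (t : B) : csgn o (insert b T) t = chi o b t * csgn o T t := by
  rw [csgn_eq_prod, csgn_eq_prod, Finset.prod_insert hb]

lemma csgn_sq {B : Type*} (o : LinearOrder B) (T : Finset B) (t : B) :
    csgn o T t * csgn o T t = 1 := by
  rw [csgn_eq_prod, ← Finset.prod_mul_distrib]
  exact Finset.prod_eq_one fun a _ => chi_sq o a t

lemma exists_sign {B : Type*} [DecidableEq B] (o : LinearOrder B) (c : B → B → ℤ)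
    (hc : ∀ a b, a ≠ b → c a b = c b a) (hc2 : ∀ a b, c a b * c a b = 1)
    (u : B → ℤ) (hu : ∀ a, u a * u a = 1) :
    ∃ ε : Finset B → ℤ, (∀ T, ε T * ε T = 1) ∧
      ∀ T t, t ∉ T → ε (insert t T) = ε T * u t * ∏ a ∈ T, c a t := by
  letI := o
  refine ⟨fun T => (∏ b ∈ T, u b) * ∏ b ∈ T, ∏ a ∈ T, if a < b then c a b else 1, ?_, ?_⟩
  · intro T
    have h1 : (∏ b ∈ T, u b) * (∏ b ∈ T, u b) = 1 := by
      rw [← Finset.prod_mul_distrib]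
      exact Finset.prod_eq_one fun a _ => hu a
    have h2 : (∏ b ∈ T, ∏ a ∈ T, if a < b then c a b else 1) *
        (∏ b ∈ T, ∏ a ∈ T, if a < b then c a b else 1) = 1 := by
      rw [← Finset.prod_mul_distrib]
      refine Finset.prod_eq_one fun b _ => ?_
      rw [← Finset.prod_mul_distrib]
      refine Finset.prod_eq_one fun a _ => ?_
      split_ifs
      · exact hc2 a b
      · rfl
    calc _ = ((∏ b ∈ T, u b) * (∏ b ∈ T, u b)) *
        ((∏ b ∈ T, ∏ a ∈ T, if a < b then c a b else 1) *
        (∏ b ∈ T, ∏ a ∈ T, if a < b then c a b else 1)) := by ring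
      _ = 1 := by rw [h1, h2, one_mul]
  · intro T t ht
    simp only [Finset.prod_insert ht, lt_irrefl, if_false, one_mul, Finset.prod_mul_distrib]
    have h3 : (∏ a ∈ T, if a < t then c a t else 1) * (∏ b ∈ T, if t < b then c t b else 1)
        = ∏ a ∈ T, c a t := by
      rw [← Finset.prod_mul_distrib]
      refine Finset.prod_congr rfl fun a ha => ?_
      have hne : a ≠ t := fun h => ht (h ▸ ha)
      rcases lt_or_gt_of_ne hne with h1 | h1
      · simp [h1, h1.not_gt]
      · simp [h1, h1.not_gt, hc a t hne]
    rw [← h3]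
    ring

lemma exists_eps {B : Type*} (o : LinearOrder B) (P : B → Prop)
    [DecidableEq (Subtype P)] (o' : LinearOrder (Subtype P))
    (u : B → ℤ) (hu : ∀ a, u a * u a = 1) :
    ∃ ε : Finset (Subtype P) → ℤ, (∀ T, ε T * ε T = 1) ∧
      ∀ T, ∀ t ∈ T, u t.1 * csgn o ((T.erase t).map (Function.Embedding.subtype P)) t.1 *
        ε (T.erase t) = ε T * csgn o' (T.erase t) t := by
  obtain ⟨ε, h1, h2⟩ := exists_sign o' (fun a b => chi o a.1 b.1 * chi o' a b)
    (fun a b hab => by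
      rw [chi_anti o (fun h => hab (Subtype.ext h)), chi_anti o' hab]; ring)
    (fun a b => by
      linear_combination (chi o' a b * chi o' a b) * chi_sq o a.1 b.1 + chi_sq o' a b)
    (fun a => u a.1) (fun a => hu a.1)
  refine ⟨ε, h1, fun T t ht => ?_⟩
  have h3 := h2 (T.erase t) t (Finset.notMem_erase t T)
  rw [Finset.insert_erase ht, Finset.prod_mul_distrib, ← csgn_eq_prod] at h3
  have h4 : csgn o ((T.erase t).map (Function.Embedding.subtype P)) t.1 =
      ∏ a ∈ T.erase t, chi o a.1 t.1 := by
    rw [csgn_eq_prod, Finset.prod_map]; rfl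
  rw [h3, h4]
  linear_combination (- ε (T.erase t) * u t.1 * ∏ a ∈ T.erase t, chi o a.1 t.1) *
    csgn_sq o' (T.erase t) t

end Signs

section Ev

variable {B : Type*} [DecidableEq B] [Fintype B]
variable {W : Type*} [Group W] {M : CoxeterMatrix B} (cs : CoxeterSystem M W)
variable (R : Type*) [CommRing R] (A : Type*) [AddCommGroup A] [Module R A]
  [DistribMulAction W A] [SMulCommClass W R A]

open Classical in
/-- Evaluation of a cochain at an arbitrary finite subset (zero if meaningless). -/
noncomputable def ev (k : ℕ) (T : Finset B) : Xc cs R A k →ₗ[R] A :=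
  if h : Indep cs T ∧ T.card = k then
    (invSub cs R A T).subtype ∘ₗ LinearMap.proj (R := R)
      (φ := fun T : {T : Finset B // Indep cs T ∧ T.card = k} => invSub cs R A T.1) ⟨T, h⟩
  else 0

lemma ev_of {k : ℕ} {T : Finset B} (h : Indep cs T ∧ T.card = k) (x : Xc cs R A k) :
    ev cs R A k T x = x ⟨T, h⟩ := by
  rw [ev, dif_pos h]; rfl

lemma ev_mem {k : ℕ} (T : Finset B) (x : Xc cs R A k) : ev cs R A k T x ∈ invSub cs R A T := by
  by_cases h : Indep cs T ∧ T.card = k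
  · rw [ev_of cs R A h]; exact (x ⟨T, h⟩).2
  · rw [ev, dif_neg h]; exact zero_mem _

lemma ev_ext {k : ℕ} {x y : Xc cs R A k}
    (h : ∀ T, Indep cs T → T.card = k → ev cs R A k T x = ev cs R A k T y) : x = y := by
  funext T
  apply Subtype.ext
  have := h T.1 T.2.1 T.2.2
  rwa [ev_of cs R A T.2, ev_of cs R A T.2] at this

/-- Build a linear map into the cochains from its components. -/
def mkX {E : Type*} [AddCommGroup E] [Module R E] (k : ℕ) (f : Finset B → E →ₗ[R] A)
    (hf : ∀ T, Indep cs T → T.card = k → ∀ x, f T x ∈ invSub cs R A T) : E →ₗ[R] Xc cs R A k :=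
  LinearMap.pi fun T => (f T.1).codRestrict (invSub cs R A T.1) (hf T.1 T.2.1 T.2.2)

lemma ev_mkX {E : Type*} [AddCommGroup E] [Module R E] (k : ℕ) (f : Finset B → E →ₗ[R] A)
    (hf : ∀ T, Indep cs T → T.card = k → ∀ x, f T x ∈ invSub cs R A T)
    {T : Finset B} (h1 : Indep cs T) (h2 : T.card = k) (x : E) :
    ev cs R A k T (mkX cs R A k f hf x) = f T x := by
  rw [ev_of cs R A ⟨h1, h2⟩]; rfl

lemma ev_Xd (o : LinearOrder B) {k : ℕ} {U : Finset B} (h1 : Indep cs U) (h2 : U.card = k + 1)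
    (x : Xc cs R A k) :
    ev cs R A (k + 1) U (Xd cs R A o k x) = ∑ t ∈ U, csgn o (U.erase t) t •
      (ev cs R A k (U.erase t) x + cs.simple t • ev cs R A k (U.erase t) x) := by
  rw [ev_of cs R A ⟨h1, h2⟩, ← Finset.sum_attach]
  refine Finset.sum_congr rfl fun t _ => ?_
  have h : Indep cs (U.erase t) ∧ (U.erase t.1).card = k :=
    ⟨h1.mono cs (Finset.erase_subset _ _), by rw [Finset.card_erase_of_mem t.2, h2]; rfl⟩
  rw [ev_of cs R A h]
  rfl

end Ev

lemma sum_antisymm {K : Type*} [Field K] (hK : (2 : K) ≠ 0) {A : Type*} [AddCommGroup A]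
    [Module K A] {B : Type*} [DecidableEq B] (U : Finset B) (f : B → B → A)
    (hf : ∀ s ∈ U, ∀ t ∈ U, s ≠ t → f s t = - f t s) :
    ∑ s ∈ U, ∑ t ∈ U.erase s, f s t = 0 := by
  have h1 : ∑ s ∈ U, ∑ t ∈ U.erase s, f s t = ∑ s ∈ U, ∑ t ∈ U, if s = t then 0 else f s t := by
    refine Finset.sum_congr rfl fun s hs => ?_
    rw [← Finset.add_sum_erase U _ hs, if_pos rfl, zero_add]
    refine Finset.sum_congr rfl fun t ht => ?_
    rw [if_neg (Finset.ne_of_mem_erase ht).symm]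
  rw [h1]
  set S := ∑ s ∈ U, ∑ t ∈ U, if s = t then 0 else f s t with hS
  have h2 : S = - S := by
    conv_lhs => rw [hS, Finset.sum_comm]
    rw [hS, ← Finset.sum_neg_distrib]
    refine Finset.sum_congr rfl fun s hs => ?_
    rw [← Finset.sum_neg_distrib]
    refine Finset.sum_congr rfl fun t ht => ?_
    by_cases h : s = t
    · simp [h]
    · rw [if_neg h, if_neg (Ne.symm h), hf t ht s hs (Ne.symm h)]
  have h3 : (2 : K) • S = 0 := by
    rw [two_smul]; nth_rewrite 1 [h2]; simp
  exact (smul_eq_zero.1 h3).resolve_left hK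

section DD

variable {B : Type*} [DecidableEq B] [Fintype B]
variable {W : Type*} [Group W] {M : CoxeterMatrix B} (cs : CoxeterSystem M W)
variable (K : Type*) [Field K] (A : Type*) [AddCommGroup A] [Module K A]
  [DistribMulAction W A] [SMulCommClass W K A]

lemma Xd_Xd (hK : (2 : K) ≠ 0) (o : LinearOrder B) (k : ℕ) (x : Xc cs K A k) :
    Xd cs K A o (k + 1) (Xd cs K A o k x) = 0 := by
  apply ev_ext
  intro U h1 h2
  rw [ev_Xd cs K A o h1 h2, map_zero]
  rw [← sum_antisymm hK U (fun s t => (csgn o (U.erase s) s * csgn o ((U.erase s).erase t) t) •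
    ((ev cs K A k ((U.erase s).erase t) x + cs.simple t • ev cs K A k ((U.erase s).erase t) x)
      + cs.simple s • (ev cs K A k ((U.erase s).erase t) x +
        cs.simple t • ev cs K A k ((U.erase s).erase t) x)))]
  · refine Finset.sum_congr rfl fun s hs => ?_
    rw [ev_Xd cs K A o (h1.mono cs (Finset.erase_subset _ _))
      (by rw [Finset.card_erase_of_mem hs, h2]; rfl), Finset.smul_sum, ← Finset.sum_add_distrib,
      Finset.smul_sum]
    refine Finset.sum_congr rfl fun t _ => ?_
    rw [mul_smul, smul_comm (cs.simple s) (csgn o ((U.erase s).erase t) t), ← smul_add]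
  · intro s hs t ht hst
    have e1 : (U.erase t).erase s = (U.erase s).erase t := Finset.erase_right_comm
    have hsU : U.erase s = insert t ((U.erase s).erase t) :=
      (Finset.insert_erase (Finset.mem_erase.2 ⟨hst.symm, ht⟩)).symm
    have htU : U.erase t = insert s ((U.erase s).erase t) := by
      rw [← e1]
      exact (Finset.insert_erase (Finset.mem_erase.2 ⟨hst, hs⟩)).symm
    have g1 : csgn o (U.erase s) s = chi o t s * csgn o ((U.erase s).erase t) s := by
      conv_lhs => rw [hsU]
      exact csgn_insert o (by simp) s
    have g2 : csgn o (U.erase t) t = chi o s t * csgn o ((U.erase s).erase t) t := by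
      conv_lhs => rw [htU]
      exact csgn_insert o (by simp) t
    simp only [e1]
    rw [g1, g2, chi_anti o hst, ← neg_smul]
    set v := ev cs K A k ((U.erase s).erase t) x
    have hc : cs.simple s • cs.simple t • v = cs.simple t • cs.simple s • v := by
      rw [smul_smul, (h1 s hs t ht hst).eq, smul_smul]
    congr 1
    · ring
    · rw [smul_add, smul_add, hc]; abel

end DD

section Main

/-- The subset of `B` underlying a subset of a subtype. -/
abbrev up {B : Type*} {P : B → Prop} (T : Finset (Subtype P)) : Finset B :=
  T.map (Function.Embedding.subtype P)

lemma mem_up {B : Type*} {P : B → Prop} (T : Finset (Subtype P)) (b : B) :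
    b ∈ up T ↔ ∃ h : P b, (⟨b, h⟩ : Subtype P) ∈ T := by
  simp [up]

lemma down_up {B : Type*} {P : B → Prop} [DecidablePred P] (T : Finset (Subtype P)) :
    (up T).subtype P = T := by
  ext ⟨b, hb⟩
  simp [hb]

lemma up_down {B : Type*} {P : B → Prop} [DecidablePred P] {T : Finset B}
    (h : ∀ b ∈ T, P b) : up (T.subtype P) = T := Finset.subtype_map_of_mem h

lemma up_erase {B : Type*} [DecidableEq B] {P : B → Prop} (T : Finset (Subtype P))
    (t : Subtype P) : up (T.erase t) = (up T).erase t.1 := Finset.map_erase _ _ _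

lemma indep_up {B : Type*} [DecidableEq B] [Fintype B]
    {W : Type*} [Group W] {M : CoxeterMatrix B} (cs : CoxeterSystem M W)
    {P : B → Prop} [DecidablePred P] {W' : Type*} [Group W'] {M' : CoxeterMatrix (Subtype P)}
    (cs' : CoxeterSystem M' W') (φ : W' →* W) (hφ : Function.Injective φ)
    (h : ∀ b : Subtype P, φ (cs'.simple b) = cs.simple b.1) (T : Finset (Subtype P)) :
    Indep cs (up T) ↔ Indep cs' T := by
  constructor
  · intro hT a ha b hb hab
    have := hT a.1 (Finset.mem_map_of_mem _ ha) b.1 (Finset.mem_map_of_mem _ hb)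
      (fun e => hab (Subtype.ext e))
    rw [← h, ← h] at this
    apply hφ
    rw [map_mul, map_mul]
    exact this
  · intro hT a ha b hb hab
    obtain ⟨pa, ha⟩ := (mem_up _ _).1 ha
    obtain ⟨pb, hb⟩ := (mem_up _ _).1 hb
    have := (hT _ ha _ hb (fun e => hab (congrArg Subtype.val e))).map φ
    rwa [h, h] at this

set_option maxHeartbeats 1000000 in
lemma main_les
    {B : Type*} [DecidableEq B] [Fintype B]
    {W : Type*} [Group W] {M : CoxeterMatrix B} (cs : CoxeterSystem M W)
    (o : LinearOrder B) (s : B)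
    (K : Type*) [Field K] (hK : (2 : K) ≠ 0)
    (V : Type*) [AddCommGroup V] [Module K V] [DistribMulAction W V] [SMulCommClass W K V]
    {W₁ : Type*} [Group W₁] {M₁ : CoxeterMatrix {b : B // b ≠ s}}
    (cs₁ : CoxeterSystem M₁ W₁) (o₁ : LinearOrder {b : B // b ≠ s})
    {W₂ : Type*} [Group W₂] {M₂ : CoxeterMatrix {b : B // b ≠ s ∧ M b s = 2}}
    (cs₂ : CoxeterSystem M₂ W₂) (o₂ : LinearOrder {b : B // b ≠ s ∧ M b s = 2})
    [DistribMulAction W₁ V] [SMulCommClass W₁ K V]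
    [DistribMulAction W₂ (invSub cs K V {s})] [SMulCommClass W₂ K (invSub cs K V {s})]
    (a₁ : ∀ (b : {b : B // b ≠ s}) (v : V), cs₁.simple b • v = cs.simple b.1 • v)
    (a₂ : ∀ (b : {b : B // b ≠ s ∧ M b s = 2}) (v : invSub cs K V {s}),
      ((cs₂.simple b • v : invSub cs K V {s}) : V) = cs.simple b.1 • (v : V))
    (i₁ : ∀ T : Finset {b : B // b ≠ s}, Indep cs (up T) ↔ Indep cs₁ T)
    (i₂ : ∀ T : Finset {b : B // b ≠ s ∧ M b s = 2}, Indep cs (up T) ↔ Indep cs₂ T) :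
    ∃ (α : ∀ i : ℕ, CoxH cs K V o i →ₗ[K] CoxH cs₁ K V o₁ i)
      (β : ∀ i : ℕ, CoxH cs₁ K V o₁ i →ₗ[K] CoxH cs₂ K (invSub cs K V {s}) o₂ i)
      (γ : ∀ i : ℕ, CoxH cs₂ K (invSub cs K V {s}) o₂ i →ₗ[K] CoxH cs K V o (i + 1)),
      Function.Injective (α 0) ∧
      (∀ i : ℕ, Function.Exact (α i) (β i)) ∧
      (∀ i : ℕ, Function.Exact (β i) (γ i)) ∧
      (∀ i : ℕ, Function.Exact (γ i) (α (i + 1))) := by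
  obtain ⟨ε₁, ε₁sq, hε₁⟩ := exists_eps o (fun b => b ≠ s) o₁ (fun _ => 1) (fun _ => rfl)
  obtain ⟨ε₂, ε₂sq, hε₂⟩ := exists_eps o (fun b => b ≠ s ∧ M b s = 2) o₂ (fun b => chi o s b)
    (fun b => chi_sq o s b)
  have hs1 : ∀ T : Finset {b : B // b ≠ s}, s ∉ up T := by
    intro T h
    obtain ⟨h, _⟩ := (mem_up _ _).1 h
    exact h rfl
  have hs2 : ∀ T : Finset {b : B // b ≠ s ∧ M b s = 2}, s ∉ up T := by
    intro T h
    obtain ⟨h, _⟩ := (mem_up _ _).1 h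
    exact h.1 rfl
  have hud1 : ∀ T : Finset B, s ∉ T → up (T.subtype (fun b => b ≠ s)) = T := by
    intro T h
    exact up_down fun b hb e => h (e ▸ hb)
  have hud2 : ∀ U : Finset B, Indep cs U → s ∈ U →
      insert s (up (U.subtype (fun b => b ≠ s ∧ M b s = 2))) = U := by
    intro U hU hs
    ext b
    rw [Finset.mem_insert, mem_up]
    constructor
    · rintro (rfl | ⟨h, hb⟩)
      · exact hs
      · simpa using hb
    · intro hb
      by_cases hbs : b = s
      · exact Or.inl hbs
      · exact Or.inr ⟨⟨hbs, two_of_commute cs hbs (hU b hb s hs hbs)⟩, by simpa using hb⟩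
  have hdu2 : ∀ T : Finset {b : B // b ≠ s ∧ M b s = 2},
      (insert s (up T)).subtype (fun b => b ≠ s ∧ M b s = 2) = T := by
    intro T
    ext ⟨b, hb⟩
    simp [hb]
  have hi2 : ∀ T : Finset {b : B // b ≠ s ∧ M b s = 2}, Indep cs₂ T →
      Indep cs (insert s (up T)) := by
    intro T hT a ha b hb hab
    rw [← i₂] at hT
    rw [Finset.mem_insert] at ha hb
    rcases ha with rfl | ha <;> rcases hb with rfl | hb
    · exact absurd rfl hab
    · obtain ⟨h, _⟩ := (mem_up _ _).1 hb
      exact (commute_simple_of_two cs h.2).symm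
    · obtain ⟨h, _⟩ := (mem_up _ _).1 ha
      exact (commute_simple_of_two cs h.2)
    · exact hT a ha b hb hab
  have hcard2 : ∀ T : Finset {b : B // b ≠ s ∧ M b s = 2},
      (insert s (up T)).card = T.card + 1 := by
    intro T
    rw [Finset.card_insert_of_notMem (hs2 T), Finset.card_map]
  have hcard1 : ∀ T : Finset {b : B // b ≠ s}, (up T).card = T.card := fun T => Finset.card_map _
  have hind2 : ∀ U : Finset B, Indep cs U → s ∈ U →
      Indep cs₂ (U.subtype (fun b => b ≠ s ∧ M b s = 2)) := by
    intro U hU hs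
    rw [← i₂]
    refine hU.mono cs ?_
    conv_rhs => rw [← hud2 U hU hs]
    exact Finset.subset_insert _ _
  have hinv2 : ∀ (T : Finset {b : B // b ≠ s ∧ M b s = 2}) (v : invSub cs K V {s}),
      v ∈ invSub cs₂ K (invSub cs K V {s}) T ↔ (v : V) ∈ invSub cs K V (insert s (up T)) := by
    intro T v
    constructor
    · intro h b hb
      rw [Finset.mem_insert] at hb
      rcases hb with rfl | hb
      · exact v.2 b (Finset.mem_singleton_self b)
      · obtain ⟨hP, hb⟩ := (mem_up _ _).1 hb
        have := congrArg Subtype.val (h _ hb)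
        rwa [a₂] at this
    · intro h b hb
      apply Subtype.ext
      rw [a₂]
      exact h _ (Finset.mem_insert_of_mem (Finset.mem_map_of_mem _ hb))
  have hinv1 : ∀ (T : Finset {b : B // b ≠ s}) (v : V),
      v ∈ invSub cs₁ K V T ↔ v ∈ invSub cs K V (up T) := by
    intro T v
    constructor
    · intro h b hb
      obtain ⟨hP, hb⟩ := (mem_up _ _).1 hb
      have := h _ hb
      rwa [a₁] at this
    · intro h b hb
      rw [a₁]
      exact h _ (Finset.mem_map_of_mem _ hb)
  -- the four maps
  let r : ∀ k, Xc cs K V k →ₗ[K] Xc cs₁ K V k := fun k =>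
    mkX cs₁ K V k (fun T => ε₁ T • ev cs K V k (up T)) (by
      intro T _ _ x
      rw [hinv1]
      exact zsmul_mem (ev_mem cs K V (up T) x) _)
  have ev_r : ∀ k T, Indep cs₁ T → T.card = k → ∀ x,
      ev cs₁ K V k T (r k x) = ε₁ T • ev cs K V k (up T) x :=
    fun k T h1 h2 x => ev_mkX cs₁ K V k _ _ h1 h2 x
  let σ : ∀ k, Xc cs₁ K V k →ₗ[K] Xc cs K V k := fun k =>
    mkX cs K V k (fun T => if s ∈ T then 0 else
        ε₁ (T.subtype (fun b => b ≠ s)) • ev cs₁ K V k (T.subtype (fun b => b ≠ s))) (by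
      intro T _ _ x
      split_ifs with h
      · exact zero_mem _
      · have h3 := ev_mem cs₁ K V (T.subtype (fun b => b ≠ s)) x
        rw [hinv1, hud1 T h] at h3
        exact zsmul_mem h3 _)
  have ev_σ : ∀ k T, Indep cs T → T.card = k → ∀ x,
      ev cs K V k T (σ k x) = if s ∈ T then 0 else
        ε₁ (T.subtype (fun b => b ≠ s)) • ev cs₁ K V k (T.subtype (fun b => b ≠ s)) x := by
    intro k T h1 h2 x
    refine (ev_mkX cs K V k _ _ h1 h2 x).trans ?_
    split_ifs <;> rfl
  let j : ∀ k, Xc cs₂ K (invSub cs K V {s}) k →ₗ[K] Xc cs K V (k + 1) := fun k =>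
    mkX cs K V (k + 1) (fun U => if s ∈ U then
        ε₂ (U.subtype (fun b => b ≠ s ∧ M b s = 2)) • ((invSub cs K V {s}).subtype ∘ₗ
          ev cs₂ K (invSub cs K V {s}) k (U.subtype (fun b => b ≠ s ∧ M b s = 2))) else 0) (by
      intro U hU _ x
      split_ifs with h
      · have h3 := ev_mem cs₂ K (invSub cs K V {s})
          (U.subtype (fun b => b ≠ s ∧ M b s = 2)) x
        rw [hinv2, hud2 U hU h] at h3
        exact zsmul_mem h3 _
      · exact zero_mem _)
  have ev_j : ∀ k U, Indep cs U → U.card = k + 1 → ∀ x,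
      ev cs K V (k + 1) U (j k x) = if s ∈ U then
        ε₂ (U.subtype (fun b => b ≠ s ∧ M b s = 2)) •
          (ev cs₂ K (invSub cs K V {s}) k (U.subtype (fun b => b ≠ s ∧ M b s = 2)) x : V)
        else 0 := by
    intro k T h1 h2 x
    refine (ev_mkX cs K V (k + 1) _ _ h1 h2 x).trans ?_
    split_ifs <;> rfl
  let q : ∀ k, Finset {b : B // b ≠ s ∧ M b s = 2} → Xc cs K V (k + 1) →ₗ[K] invSub cs K V {s} :=
    fun k T => (ε₂ T • ev cs K V (k + 1) (insert s (up T))).codRestrict (invSub cs K V {s}) (by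
      intro x b hb
      rw [Finset.mem_singleton] at hb
      subst hb
      have h3 := ev_mem cs K V (insert b (up T)) x
      exact (zsmul_mem h3 (ε₂ T)) b (Finset.mem_insert_self _ _))
  let p : ∀ k, Xc cs K V (k + 1) →ₗ[K] Xc cs₂ K (invSub cs K V {s}) k := fun k =>
    mkX cs₂ K (invSub cs K V {s}) k (q k) (by
      intro T _ _ x
      rw [hinv2]
      exact zsmul_mem (ev_mem cs K V (insert s (up T)) x) _)
  have ev_p : ∀ k T, Indep cs₂ T → T.card = k → ∀ x,
      (ev cs₂ K (invSub cs K V {s}) k T (p k x) : V) =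
        ε₂ T • ev cs K V (k + 1) (insert s (up T)) x := by
    intro k T h1 h2 x
    exact congrArg Subtype.val (ev_mkX cs₂ K (invSub cs K V {s}) k _ _ h1 h2 x)
  refine abstract_les (fun i => Xd cs K V o i) (fun i => Xd cs₁ K V o₁ i)
    (fun i => Xd cs₂ K (invSub cs K V {s}) o₂ i)
    (Zc cs K V o) (Zc cs₁ K V o₁) (Zc cs₂ K (invSub cs K V {s}) o₂)
    (Bc cs K V o) (Bc cs₁ K V o₁) (Bc cs₂ K (invSub cs K V {s}) o₂)
    (fun _ _ => Iff.rfl) (fun _ _ => Iff.rfl) (fun _ _ => Iff.rfl)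
    (fun _ => Iff.rfl) (fun _ _ => Iff.rfl)
    (fun _ => Iff.rfl) (fun _ _ => Iff.rfl)
    (fun _ => Iff.rfl) (fun _ _ => Iff.rfl)
    r σ j p (fun i x => Xd_Xd cs K V hK o i x) ?_ ?_ ?_ ?_ ?_ ?_ ?_
  · -- `r` is a chain map
    intro k x
    apply ev_ext
    intro T h1 h2
    rw [ev_r _ _ h1 h2, ev_Xd cs₁ K V o₁ h1 h2,
      ev_Xd cs K V o ((i₁ T).2 h1) ((hcard1 T).trans h2), Finset.sum_map, Finset.smul_sum]
    refine Finset.sum_congr rfl fun t ht => ?_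
    have e1 : (Function.Embedding.subtype (fun b => b ≠ s)) t = t.1 := rfl
    rw [ev_r k (T.erase t) (h1.mono cs₁ (Finset.erase_subset _ _))
      (by rw [Finset.card_erase_of_mem ht, h2]; rfl), a₁, e1, ← up_erase,
      smul_comm (cs.simple t.1) (ε₁ (T.erase t)), ← smul_add, smul_smul, smul_smul]
    congr 1
    have := hε₁ T t ht
    have q1 := ε₁sq T
    have q2 := ε₁sq (T.erase t)
    linear_combination (csgn o₁ (T.erase t) t * ε₁ (T.erase t)) * q1 -
      ε₁ T * csgn o (up (T.erase t)) t.1 * q2 + ε₁ T * ε₁ (T.erase t) * this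
  · -- `j` is a chain map
    intro k y
    apply ev_ext
    intro U h1 h2
    have hsub : ∀ t ∈ U, ev cs K V (k + 1) (U.erase t) (j k y) = _ := fun t ht =>
      ev_j k (U.erase t) (h1.mono cs (Finset.erase_subset _ _))
        (by rw [Finset.card_erase_of_mem ht, h2]; rfl) y
    rw [ev_j (k + 1) U h1 h2, ev_Xd cs K V o h1 h2]
    by_cases hs : s ∈ U
    · rw [if_pos hs, ← Finset.add_sum_erase U _ hs, hsub s hs, if_neg (Finset.notMem_erase s U)]
      have hT := hind2 U h1 hs
      have hU := hud2 U h1 hs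
      set T := U.subtype (fun b => b ≠ s ∧ M b s = 2) with hTdef
      have hTc : T.card = k + 1 := by
        have := hcard2 T
        rw [hU, h2] at this
        omega
      have hUe : U.erase s = up T := by
        rw [← hU, Finset.erase_insert (hs2 T)]
      rw [ev_Xd cs₂ K _ o₂ hT hTc, hUe, Finset.sum_map, smul_zero, add_zero, smul_zero, zero_add,
        AddSubmonoidClass.coe_finsetSum, Finset.smul_sum]
      refine Finset.sum_congr rfl fun t ht => ?_
      have e1 : (Function.Embedding.subtype (fun b => b ≠ s ∧ M b s = 2)) t = t.1 := rfl
      have htU : t.1 ∈ U := by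
        rw [← hU]; exact Finset.mem_insert_of_mem (Finset.mem_map_of_mem _ ht)
      have e2 : U.erase t.1 = insert s (up (T.erase t)) := by
        rw [up_erase, ← Finset.erase_insert_of_ne t.2.1.symm, hU]
      rw [e1, hsub t.1 htU, if_pos (Finset.mem_erase.2 ⟨t.2.1.symm, hs⟩), e2, hdu2,
        csgn_insert o (hs2 _), smul_comm (cs.simple t.1) (ε₂ (T.erase t)), ← smul_add, smul_smul,
        hε₂ T t ht, mul_smul, AddSubgroupClass.coe_zsmul, Submodule.coe_add, a₂]
    · rw [if_neg hs]
      refine Finset.sum_eq_zero fun t ht => ?_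
      rw [hsub t ht, if_neg (fun h => hs (Finset.mem_of_mem_erase h)), smul_zero, add_zero,
        smul_zero]
  · -- `r ∘ σ = id`
    intro k x
    apply ev_ext
    intro T h1 h2
    rw [ev_r _ _ h1 h2, ev_σ k _ ((i₁ T).2 h1) ((hcard1 T).trans h2), if_neg (hs1 T), down_up,
      smul_smul, ε₁sq, one_smul]
  · -- `p ∘ j = id`
    intro k y
    apply ev_ext
    intro T h1 h2
    apply Subtype.ext
    rw [ev_p _ _ h1 h2, ev_j k _ (hi2 T h1) ((hcard2 T).trans (by rw [h2])),
      if_pos (Finset.mem_insert_self _ _), hdu2, smul_smul, ε₂sq, one_smul]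
  · -- `r ∘ j = 0`
    intro k y
    apply ev_ext
    intro T h1 h2
    rw [ev_r _ _ h1 h2, ev_j k _ ((i₁ T).2 h1) ((hcard1 T).trans h2), if_neg (hs1 T), smul_zero,
      map_zero]
  · intro x
    apply ev_ext
    intro T h1 h2
    have hs : s ∉ T := by
      rw [Finset.card_eq_zero] at h2
      simp [h2]
    have hu := hud1 T hs
    rw [ev_σ 0 T h1 h2, if_neg hs, ev_r 0 _ ((i₁ _).1 (hu.symm ▸ h1))
      (by rw [← hcard1, hu, h2]), hu, smul_smul, ε₁sq, one_smul]
  · intro k x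
    apply ev_ext
    intro T h1 h2
    rw [map_add, ev_σ (k + 1) T h1 h2, ev_j k T h1 h2]
    by_cases hs : s ∈ T
    · have hu := hud2 T h1 hs
      have hc := hcard2 (T.subtype (fun b => b ≠ s ∧ M b s = 2))
      rw [hu, h2] at hc
      rw [if_pos hs, if_pos hs, zero_add, ev_p k _ (hind2 T h1 hs) (by omega), hu, smul_smul,
        ε₂sq, one_smul]
    · have hu := hud1 T hs
      rw [if_neg hs, if_neg hs, add_zero, ev_r (k + 1) _ ((i₁ _).1 (hu.symm ▸ h1))
        (by rw [← hcard1, hu, h2]), hu, smul_smul, ε₁sq, one_smul]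

end Main

section Statement

set_option maxHeartbeats 1000000 in
/-- Proposition `les`: let `(G,S)` be a Coxeter system, `V` a representation of
`G` over a field of characteristic `≠ 2`, and `s ∈ S`.  Let `G_s = ⟨S ∖ {s}⟩` and
`G^s = ⟨S ∖ B_s(1)⟩`, where `B_s(1)` consists of `s` and all vertices adjacent to `s` in the
Coxeter graph (so that `S ∖ B_s(1)` is indexed by `{b // b ≠ s ∧ M b s = 2}`, every element of
`G^s` commutes with `s`, and the invariant subspace `V^s` is a `G^s`-representation).  Then
there is a long exact sequence
`⋯ → H^{i-1}_C(G^s, V^s) → H^i_C(G,V) → H^i_C(G_s, V) → H^i_C(G^s, V^s) → ⋯`. -/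
theorem coxeter_cohomology_parabolic_long_exact_sequence
    {B : Type*} [DecidableEq B] [Fintype B]
    {W : Type*} [Group W] {M : CoxeterMatrix B} (cs : CoxeterSystem M W)
    (o : LinearOrder B) (s : B)
    (K : Type*) [Field K] (hK : (2 : K) ≠ 0)
    (V : Type*) [AddCommGroup V] [Module K V] [DistribMulAction W V] [SMulCommClass W K V]
    -- the Coxeter system `G_s = ⟨S ∖ {s}⟩`
    {W₁ : Type*} [Group W₁] {M₁ : CoxeterMatrix {b : B // b ≠ s}}
    (cs₁ : CoxeterSystem M₁ W₁) (o₁ : LinearOrder {b : B // b ≠ s})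
    (φ₁ : W₁ →* W) (hφ₁ : Function.Injective φ₁)
    (h₁ : ∀ b : {b : B // b ≠ s}, φ₁ (cs₁.simple b) = cs.simple b.1)
    -- the Coxeter system `G^s = ⟨S ∖ B_s(1)⟩`
    {W₂ : Type*} [Group W₂] {M₂ : CoxeterMatrix {b : B // b ≠ s ∧ M b s = 2}}
    (cs₂ : CoxeterSystem M₂ W₂) (o₂ : LinearOrder {b : B // b ≠ s ∧ M b s = 2})
    (φ₂ : W₂ →* W) (hφ₂ : Function.Injective φ₂)
    (h₂ : ∀ b : {b : B // b ≠ s ∧ M b s = 2}, φ₂ (cs₂.simple b) = cs.simple b.1) :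
    -- `V` as a `G_s`-representation, by restriction along `φ₁`
    letI : DistribMulAction W₁ V := DistribMulAction.compHom V φ₁
    letI : SMulCommClass W₁ K V := ⟨fun w c v => smul_comm (φ₁ w) c v⟩
    -- `V^s` as a `G^s`-representation
    letI : DistribMulAction W₂ (invSub cs K V {s}) :=
      parabolicInvAction cs s cs₂ φ₂ h₂ K V
    letI : SMulCommClass W₂ K (invSub cs K V {s}) :=
      ⟨fun w c v => Subtype.ext
        (show φ₂ w • (c • v.1) = c • (φ₂ w • v.1) from smul_comm _ _ _)⟩
    ∃ (α : ∀ i : ℕ, CoxH cs K V o i →ₗ[K] CoxH cs₁ K V o₁ i)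
      (β : ∀ i : ℕ, CoxH cs₁ K V o₁ i →ₗ[K] CoxH cs₂ K (invSub cs K V {s}) o₂ i)
      (γ : ∀ i : ℕ, CoxH cs₂ K (invSub cs K V {s}) o₂ i →ₗ[K] CoxH cs K V o (i + 1)),
      Function.Injective (α 0) ∧
      (∀ i : ℕ, Function.Exact (α i) (β i)) ∧
      (∀ i : ℕ, Function.Exact (β i) (γ i)) ∧
      (∀ i : ℕ, Function.Exact (γ i) (α (i + 1))) := by
  letI : DistribMulAction W₁ V := DistribMulAction.compHom V φ₁
  letI : SMulCommClass W₁ K V := ⟨fun w c v => smul_comm (φ₁ w) c v⟩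
  letI : DistribMulAction W₂ (invSub cs K V {s}) :=
    parabolicInvAction cs s cs₂ φ₂ h₂ K V
  letI : SMulCommClass W₂ K (invSub cs K V {s}) :=
    ⟨fun w c v => Subtype.ext
      (show φ₂ w • (c • v.1) = c • (φ₂ w • v.1) from smul_comm _ _ _)⟩
  exact main_les cs o s K hK V cs₁ o₁ cs₂ o₂
    (fun b v => congrArg (fun w : W => w • v) (h₁ b))
    (fun b v => congrArg (fun w : W => w • (v : V)) (h₂ b))
    (indep_up cs cs₁ φ₁ hφ₁ h₁) (indep_up cs cs₂ φ₂ hφ₂ h₂)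

end Statement
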